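/- Let δ be a finite signature and σ ⊆ δ. Suppose N_i = N_i⁰ ◁ … ◁ N_i^{N−1} for i=1,2 and some 0<N<ω, where each N_i^ℓ is an ordered sum of finitely many simple δ-models based on atomic frames, and let x_i be a root of the frame underlying N_i⁰. If x₁ and x₂ satisfy exactly the same variables of σ and, for every ℓ<N, the pair (N₁^ℓ, N₂^ℓ) is σ-matching, then N₁,x₁ ∼_σ N₂,x₂. -/

import Mathlib

/-! ## Modal formulas -/

inductive MF : Type
  | var : ℕ → MF
  | top : MF
  | bot : MF
  | neg : MF → MF
  | and : MF → MF → MF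
  | dia : MF → MF
deriving DecidableEq

namespace MF

def or (φ ψ : MF) : MF := .neg (.and (.neg φ) (.neg ψ))
def imp (φ ψ : MF) : MF := MF.or (.neg φ) ψ
def box (φ : MF) : MF := .neg (.dia (.neg φ))
def diaPlus (φ : MF) : MF := MF.or φ (.dia φ)
def boxPlus (φ : MF) : MF := .and φ (box φ)

/-- the propositional variables occurring in a formula -/
def vars : MF → Finset ℕ
  | .var p => {p}
  | .top => ∅
  | .bot => ∅
  | .neg φ => vars φ
  | .and φ ψ => vars φ ∪ vars ψ
  | .dia φ => vars φ

/-- the signature of a formula -/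
def sig (φ : MF) : Set ℕ := ↑(vars φ)

/-- subformulas -/
def subs : MF → Finset MF
  | .var p => {.var p}
  | .top => {.top}
  | .bot => {.bot}
  | .neg φ => insert (.neg φ) (subs φ)
  | .and φ ψ => insert (.and φ ψ) (subs φ ∪ subs ψ)
  | .dia φ => insert (.dia φ) (subs φ)

/-- `|φ|`: the number of subformulas of `φ` together with their negations -/
def size (φ : MF) : ℕ := ((subs φ) ∪ (subs φ).image MF.neg).card

/-- uniform substitution -/
def substVar (s : ℕ → MF) : MF → MF
  | .var p => s p
  | .top => .top
  | .bot => .bot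
  | .neg φ => .neg (substVar s φ)
  | .and φ ψ => .and (substVar s φ) (substVar s ψ)
  | .dia φ => .dia (substVar s φ)

end MF

/-- a Boolean evaluation of modal formulas (treating `◇`-formulas and variables as atoms) -/
def BoolEval (f : MF → Prop) : Prop :=
  f .top ∧ ¬ f .bot ∧ (∀ φ, f (.neg φ) ↔ ¬ f φ) ∧ (∀ φ ψ, f (.and φ ψ) ↔ (f φ ∧ f ψ))

/-- Boolean tautologies in the modal language -/
def MF.Tautology (φ : MF) : Prop := ∀ f : MF → Prop, BoolEval f → f φ

/-- normal modal logics -/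
structure IsNormalLogic (L : Set MF) : Prop where
  taut : ∀ φ, φ.Tautology → φ ∈ L
  axK : MF.imp (MF.box (MF.imp (.var 0) (.var 1)))
          (MF.imp (MF.box (.var 0)) (MF.box (.var 1))) ∈ L
  mp : ∀ φ ψ, φ ∈ L → MF.imp φ ψ ∈ L → ψ ∈ L
  subst : ∀ φ s, φ ∈ L → MF.substVar s φ ∈ L
  nec : ∀ φ, φ ∈ L → MF.box φ ∈ L

/-- the smallest normal modal logic containing `Γ` -/
def NormClosure (Γ : Set MF) : Set MF :=
  {φ | ∀ L : Set MF, IsNormalLogic L → Γ ⊆ L → φ ∈ L}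

def ax4 : MF := MF.imp (MF.box (.var 0)) (MF.box (MF.box (.var 0)))
def ax43 : MF := MF.or (MF.box (MF.imp (MF.boxPlus (.var 0)) (.var 1)))
                       (MF.box (MF.imp (MF.boxPlus (.var 1)) (.var 0)))
def axGL : MF := MF.imp (MF.box (MF.imp (MF.box (.var 0)) (.var 0))) (MF.box (.var 0))

def K4 : Set MF := NormClosure {ax4}
def K43 : Set MF := NormClosure {ax4, ax43}
def GL3 : Set MF := NormClosure {ax4, ax43, axGL}

/-! ## General frames and models -/

/-- a (general) frame: a relation together with a collection of "internal" sets -/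
structure KFrame (W : Type) where
  R : W → W → Prop
  P : Set (Set W)

namespace KFrame

variable {W : Type}

def dia (F : KFrame W) (X : Set W) : Set W := {x | ∃ y ∈ X, F.R x y}

/-- the conditions making `F` a general frame -/
def IsGeneral (F : KFrame W) : Prop :=
  Nonempty W ∧ ∅ ∈ F.P ∧ Set.univ ∈ F.P ∧
    (∀ X ∈ F.P, ∀ Y ∈ F.P, X ∩ Y ∈ F.P) ∧
    (∀ X ∈ F.P, Xᶜ ∈ F.P) ∧ (∀ X ∈ F.P, F.dia X ∈ F.P)

/-- differentiated, tight and compact -/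
def Descriptive (F : KFrame W) : Prop :=
  (∀ x y : W, (∀ X ∈ F.P, x ∈ X ↔ y ∈ X) → x = y) ∧
  (∀ x y : W, F.R x y ↔ ∀ X ∈ F.P, y ∈ X → x ∈ F.dia X) ∧
  (∀ 𝒳 : Set (Set W), 𝒳 ⊆ F.P →
    (∀ 𝒴 : Set (Set W), 𝒴 ⊆ 𝒳 → 𝒴.Finite → (⋂₀ 𝒴).Nonempty) → (⋂₀ 𝒳).Nonempty)

/-- `x` is a root of `F` (every point is reachable from `x` via the reflexive closure) -/
def Rooted (F : KFrame W) (x : W) : Prop := ∀ y : W, x = y ∨ F.R x y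

/-- the strict order on clusters: `C(x) <_R C(y)` -/
def clLT (F : KFrame W) (x y : W) : Prop := F.R x y ∧ ¬ F.R y x

/-- the cluster of a point -/
def cluster (F : KFrame W) (x : W) : Set W := insert x {y | F.R x y ∧ F.R y x}

def clLE (F : KFrame W) (x y : W) : Prop := y ∈ F.cluster x ∨ F.clLT x y

/-- the closed interval of clusters `[C(x), C(y)]` -/
def interval (F : KFrame W) (x y : W) : Set W := {z | F.clLE x z ∧ F.clLE z y}

/-- `C(x)` is the final cluster -/
def FinalCl (F : KFrame W) (x : W) : Prop := ∀ y, ¬ F.clLT x y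

/-- `C(y)` is an immediate successor of `C(x)` -/
def ImmSucc (F : KFrame W) (x y : W) : Prop :=
  F.clLT x y ∧ ¬ ∃ z, F.clLT x z ∧ F.clLT z y

/-- `C(x)` is a limit cluster -/
def LimitCl (F : KFrame W) (x : W) : Prop := ¬ F.FinalCl x ∧ ¬ ∃ y, F.ImmSucc x y

/-- `C(x)` is a degenerate cluster -/
def DegenerateCl (F : KFrame W) (x : W) : Prop := ¬ F.R x x

end KFrame

/-- the closure of a family of sets under `∩`, complement and `◇` -/
inductive genBy {W : Type} (R : W → W → Prop) (G : Set (Set W)) : Set W → Prop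
  | basic {X : Set W} : X ∈ G → genBy R G X
  | empty : genBy R G ∅
  | univ : genBy R G Set.univ
  | inter {X Y : Set W} : genBy R G X → genBy R G Y → genBy R G (X ∩ Y)
  | compl {X : Set W} : genBy R G X → genBy R G Xᶜ
  | dia {X : Set W} : genBy R G X → genBy R G {x | ∃ y ∈ X, R x y}

def KFrame.GeneratedBy {W : Type} (F : KFrame W) (G : Set (Set W)) : Prop :=
  F.P = {X | genBy F.R G X}

def KFrame.FinGenerated {W : Type} (F : KFrame W) : Prop :=
  ∃ G : Set (Set W), G.Finite ∧ F.GeneratedBy G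

def KFrame.NGenerated {W : Type} (F : KFrame W) (n : ℕ) : Prop :=
  ∃ G : Set (Set W), G.Finite ∧ G.ncard = n ∧ F.GeneratedBy G

/-- a model: a frame with a valuation -/
structure KModel (W : Type) where
  F : KFrame W
  v : ℕ → Set W

namespace KModel

variable {W : Type}

/-- the frame is a general frame and all values of the valuation are internal -/
def IsModel (M : KModel W) : Prop := M.F.IsGeneral ∧ ∀ p, M.v p ∈ M.F.P

/-- truth at a point -/
def sat (M : KModel W) : W → MF → Prop
  | x, .var p => x ∈ M.v p
  | _, .top => True
  | _, .bot => False
  | x, .neg φ => ¬ sat M x φ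
  | x, .and φ ψ => sat M x φ ∧ sat M x ψ
  | x, .dia φ => ∃ y, M.F.R x y ∧ sat M y φ

/-- a set is definable in `M` -/
def Definable (M : KModel W) (X : Set W) : Prop := ∃ φ : MF, X = {x | M.sat x φ}

/-- every internal set is definable in `M` -/
def MGenerated (M : KModel W) : Prop := ∀ X ∈ M.F.P, M.Definable X

/-- finitely `M`-generated -/
def FinMGenerated (M : KModel W) : Prop := M.MGenerated ∧ M.F.FinGenerated

/-- the σ-type of a point: all σ-formulas true at it -/
def stype (M : KModel W) (σ : Set ℕ) (x : W) : Set MF := {φ | φ.sig ⊆ σ ∧ M.sat x φ}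

/-- `x` is `Γ`-maximal in `M` -/
def MaxFor (M : KModel W) (Γ : Set MF) (x : W) : Prop :=
  (∀ γ ∈ Γ, M.sat x γ) ∧ ∀ y, M.F.R x y → (∀ γ ∈ Γ, M.sat y γ) → M.F.R y x

/-- the cluster `C(x)` is `μ`-maximal in `M` -/
def ClMuMax (M : KModel W) (μ : MF) (x : W) : Prop := ∃ z ∈ M.F.cluster x, M.MaxFor {μ} z

/-- the cluster `C(x)` is maximal in `M` -/
def ClMax (M : KModel W) (x : W) : Prop := ∃ μ : MF, M.ClMuMax μ x

/-- the cluster `C(x)` is σ-maximal in `M` -/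
def ClSigMax (M : KModel W) (σ : Set ℕ) (x : W) : Prop :=
  ∃ μ : MF, μ.sig ⊆ σ ∧ M.ClMuMax μ x

/-- the cluster `C(x)` is definable in `M` -/
def ClDefinable (M : KModel W) (x : W) : Prop := M.Definable (M.F.cluster x)

/-- `◇ t^σ_M(x) ⊆ t^σ_M(y)` -/
def diaSubset (M : KModel W) (σ : Set ℕ) (x y : W) : Prop :=
  ∀ φ ∈ M.stype σ x, MF.dia φ ∈ M.stype σ y

/-- the σ-block of a point -/
def sblockOf (M : KModel W) (σ : Set ℕ) (x : W) : Set W :=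
  {y | (M.diaSubset σ x x ∧ M.diaSubset σ y x ∧ M.diaSubset σ x y) ∨
       (¬ M.diaSubset σ x x ∧ y = x)}

/-- a σ-block in `M` -/
def IsSBlock (M : KModel W) (σ : Set ℕ) (b : Set W) : Prop := ∃ x, b = M.sblockOf σ x

/-- a degenerate σ-block in `M` -/
def DegenSBlock (M : KModel W) (σ : Set ℕ) (b : Set W) : Prop :=
  ∃ x, b = M.sblockOf σ x ∧ ¬ M.diaSubset σ x x

end KModel

/-- validity of a formula on a frame -/
def KFrame.Valid {W : Type} (F : KFrame W) (φ : MF) : Prop :=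
  ∀ v : ℕ → Set W, (∀ p, v p ∈ F.P) → ∀ x, (KModel.mk F v).sat x φ

/-- `F` is a frame for the logic `L` -/
def KFrame.IsFrameFor {W : Type} (F : KFrame W) (L : Set MF) : Prop :=
  ∀ φ ∈ L, F.Valid φ

/-! ## Bisimulations -/

def IsBisim {W₁ W₂ : Type} (σ : Set ℕ) (M₁ : KModel W₁) (M₂ : KModel W₂)
    (β : W₁ → W₂ → Prop) : Prop :=
  ∀ x₁ x₂, β x₁ x₂ →
    (∀ p ∈ σ, x₁ ∈ M₁.v p ↔ x₂ ∈ M₂.v p) ∧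
    (∀ y₁, M₁.F.R x₁ y₁ → ∃ y₂, M₂.F.R x₂ y₂ ∧ β y₁ y₂) ∧
    (∀ y₂, M₂.F.R x₂ y₂ → ∃ y₁, M₁.F.R x₁ y₁ ∧ β y₁ y₂)

def Bisimilar {W₁ W₂ : Type} (σ : Set ℕ) (M₁ : KModel W₁) (x₁ : W₁)
    (M₂ : KModel W₂) (x₂ : W₂) : Prop :=
  ∃ β, IsBisim σ M₁ M₂ β ∧ β x₁ x₂

/-- the two points satisfy the same variables of `σ` -/
def SigAgree {W₁ W₂ : Type} (σ : Set ℕ) (M₁ : KModel W₁) (x₁ : W₁)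
    (M₂ : KModel W₂) (x₂ : W₂) : Prop :=
  ∀ p ∈ σ, x₁ ∈ M₁.v p ↔ x₂ ∈ M₂.v p

/-- the two points have the same σ-type -/
def TypeEquiv {W₁ W₂ : Type} (σ : Set ℕ) (M₁ : KModel W₁) (x₁ : W₁)
    (M₂ : KModel W₂) (x₂ : W₂) : Prop :=
  ∀ φ : MF, φ.sig ⊆ σ → (M₁.sat x₁ φ ↔ M₂.sat x₂ φ)

/-! ## Interpolants -/

def IsInterpolant (L : Set MF) (φ₁ φ₂ ι : MF) : Prop :=
  ι.sig ⊆ φ₁.sig ∩ φ₂.sig ∧ MF.imp φ₁ ι ∈ L ∧ MF.imp ι φ₂ ∈ L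

def NoInterpolant (L : Set MF) (φ₁ φ₂ : MF) : Prop := ¬ ∃ ι, IsInterpolant L φ₁ φ₂ ι

def HasCIP (L : Set MF) : Prop :=
  ∀ φ₁ φ₂ : MF, MF.imp φ₁ φ₂ ∈ L → ∃ ι, IsInterpolant L φ₁ φ₂ ι

/-- `k(φ₁,φ₂) = 3 + 3·max(|φ₁|,|φ₂|)` -/
def kBound (φ₁ φ₂ : MF) : ℕ := 3 + 3 * max φ₁.size φ₂.size

/-- the conjunction of a finite list of formulas -/
def conjList : List MF → MF
  | [] => .top
  | φ :: l => .and φ (conjList l)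

/-! ## d-persistence and cofinal subframe logics -/

def DPersistent (L : Set MF) : Prop :=
  ∀ (W : Type) (F : KFrame W), F.IsGeneral → F.Descriptive → F.IsFrameFor L →
    KFrame.IsFrameFor ⟨F.R, (Set.univ : Set (Set W))⟩ L

def CofinalSet {W : Type} (F : KFrame W) (S : Set W) : Prop :=
  ∀ x ∈ S, ∀ y, F.R x y → y ∈ S ∨ ∃ z ∈ S, F.R y z

/-- the subframe of `F` with underlying set `S` and internal sets `Q` -/
def subframeOn {W : Type} (F : KFrame W) (S : Set W) (Q : Set (Set W)) : KFrame S :=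
  ⟨fun a b => F.R a.1 b.1, {T | ∃ X ∈ Q, T = (Subtype.val ⁻¹' X : Set S)}⟩

/-- the class of general frames of `L` is closed under cofinal subframes -/
def CofinalSubframeLogic (L : Set MF) : Prop :=
  ∀ (W : Type) (F : KFrame W) (S : Set W) (Q : Set (Set W)),
    F.IsGeneral → F.IsFrameFor L → Q ⊆ F.P → (∀ X ∈ Q, X ⊆ S) →
    (subframeOn F S Q).IsGeneral → CofinalSet F S →
    (subframeOn F S Q).IsFrameFor L

/-- the subframe of `F` generated by a point `x` -/
def KFrame.genSub {W : Type} (F : KFrame W) (x : W) :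
    KFrame {y : W // x = y ∨ F.R x y} :=
  ⟨fun a b => F.R a.1 b.1, {S | ∃ X ∈ F.P, S = Subtype.val ⁻¹' X}⟩

/-! ## Ordered sums, simple models and atomic frames -/

/-- the relation of an ordered sum of frames -/
def sumR {n : ℕ} {V : Fin n → Type} (Rs : ∀ j, V j → V j → Prop) :
    (Σ j, V j) → (Σ j, V j) → Prop :=
  fun x y => x.1 < y.1 ∨ ∃ h : x.1 = y.1, Rs y.1 (cast (congrArg V h) x.2) y.2

/-- the ordered sum `F₀ ◁ ⋯ ◁ F_{n-1}` of general frames -/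
def sumFrame {n : ℕ} {V : Fin n → Type} (Fs : ∀ j, KFrame (V j)) : KFrame (Σ j, V j) :=
  ⟨sumR (fun j => (Fs j).R),
   {X | ∀ j, (fun v => (⟨j, v⟩ : Σ j, V j)) ⁻¹' X ∈ (Fs j).P}⟩

/-- the ordered sum `M₀ ◁ ⋯ ◁ M_{n-1}` of models -/
def sumModel {n : ℕ} {V : Fin n → Type} (Ms : ∀ j, KModel (V j)) : KModel (Σ j, V j) :=
  ⟨sumFrame (fun j => (Ms j).F), fun p => {x | x.2 ∈ (Ms x.1).v p}⟩

/-- an isomorphism of general frames -/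
structure KFrameIso {W₁ W₂ : Type} (F₁ : KFrame W₁) (F₂ : KFrame W₂) where
  e : W₁ ≃ W₂
  hR : ∀ x y, F₁.R x y ↔ F₂.R (e x) (e y)
  hP : ∀ X : Set W₁, X ∈ F₁.P ↔ e '' X ∈ F₂.P

/-- `m^<` : a strict chain of `m` irreflexive points (as a Kripke frame) -/
def chainFrame (m : ℕ) : KFrame (Fin m) := ⟨fun i j => i < j, Set.univ⟩

/-- `◦₁ ◁ m^<` : a reflexive point followed by a strict chain of `m` irreflexive points -/
def reflChainFrame (m : ℕ) : KFrame (Fin (m + 1)) :=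
  ⟨fun i j => i < j ∨ (i = 0 ∧ j = 0), Set.univ⟩

/-- `◦_k` : a single cluster with `k` reflexive points (as a Kripke frame) -/
def clusterFrame (k : ℕ) : KFrame (Fin k) := ⟨fun _ _ => True, Set.univ⟩

/-- the accessibility relation of the frame `C(k,∗)`; `refl = true` gives `∘`-points `b_n` -/
def tadpoleR (k : ℕ) (refl : Bool) : (Fin k ⊕ ℕ) → (Fin k ⊕ ℕ) → Prop
  | Sum.inl _, _ => True
  | Sum.inr _, Sum.inl _ => False
  | Sum.inr n, Sum.inr m => m < n ∨ (refl = true ∧ m = n)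

/-- the generator `X_i = {a_i} ∪ {b_n | n ≡ i (mod k)}` -/
def tadpoleX (k : ℕ) (i : Fin k) : Set (Fin k ⊕ ℕ) :=
  {x | x = Sum.inl i ∨ ∃ n : ℕ, x = Sum.inr n ∧ n % k = i.val}

/-- the generators of the internal sets of `C(k,∗)` -/
def tadpoleGen (k : ℕ) : Set (Set (Fin k ⊕ ℕ)) :=
  {X | (∃ n : ℕ, X = {Sum.inr n}) ∨ ∃ i : Fin k, X = tadpoleX k i}

/-- the general frame `C(k,∗)` -/
def tadpoleFrame (k : ℕ) (refl : Bool) : KFrame (Fin k ⊕ ℕ) :=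
  ⟨tadpoleR k refl, {X | genBy (tadpoleR k refl) (tadpoleGen k) X}⟩

/-- `M` is a `δ`-model: variables outside `δ` get the empty value -/
def IsDeltaModel {W : Type} (δ : Finset ℕ) (M : KModel W) : Prop := ∀ p ∉ δ, M.v p = ∅

/-- a simple `δ`-model: either based on a finite Kripke frame, or based on some `C(k,∗)`
with the value of each `p ∈ δ` a union of some of the generators `X_i` -/
def IsSimpleModel {W : Type} (δ : Finset ℕ) (M : KModel W) : Prop :=
  (Finite W ∧ M.F.P = Set.univ) ∨
  (∃ k : ℕ, 0 < k ∧ ∃ (refl : Bool) (iso : KFrameIso M.F (tadpoleFrame k refl)),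
     ∀ p ∈ δ, ∃ A : Set (Fin k), iso.e '' M.v p = ⋃ i ∈ A, tadpoleX k i)

/-- `F` is an atomic frame (relative to `δ`) of size `s` -/
def IsAtomicFrameSize {W : Type} (δ : Finset ℕ) (F : KFrame W) (s : ℕ) : Prop :=
  (∃ m : ℕ, 0 < m ∧ s = m ∧ Nonempty (KFrameIso F (chainFrame m))) ∨
  (∃ m : ℕ, 0 < m ∧ s = 1 + m ∧ Nonempty (KFrameIso F (reflChainFrame m))) ∨
  (∃ k : ℕ, 0 < k ∧ k ≤ 2 ^ δ.card ∧ s = k ∧ Nonempty (KFrameIso F (clusterFrame k))) ∨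
  (∃ k : ℕ, 0 < k ∧ k ≤ 2 ^ δ.card ∧ s = k ∧
     ∃ refl : Bool, Nonempty (KFrameIso F (tadpoleFrame k refl)))

/-- `F` is an atomic frame (relative to `δ`) -/
def IsAtomicFrame {W : Type} (δ : Finset ℕ) (F : KFrame W) : Prop :=
  ∃ s, IsAtomicFrameSize δ F s

/-- the last index of `Fin n` -/
def lastIdx (n : ℕ) (h : 0 < n) : Fin n := ⟨n - 1, Nat.sub_lt h Nat.one_pos⟩

/-- the pair of ordered sums `(N₁, N₂)` (given by families of simple models) is σ-matching -/
def SigMatching (δ : Finset ℕ) (σ : Set ℕ) {n₁ n₂ : ℕ}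
    {V₁ : Fin n₁ → Type} {V₂ : Fin n₂ → Type}
    (M₁s : ∀ j, KModel (V₁ j)) (M₂s : ∀ j, KModel (V₂ j)) : Prop :=
  -- (a) both are simple models based on one and the same atomic frame, with the
  -- same atomic σ-types at corresponding points
  (IsSimpleModel δ (sumModel M₁s) ∧ IsSimpleModel δ (sumModel M₂s) ∧
   IsAtomicFrame δ (sumModel M₁s).F ∧ IsAtomicFrame δ (sumModel M₂s).F ∧
   ∃ iso : KFrameIso (sumModel M₁s).F (sumModel M₂s).F,
     ∀ y, SigAgree σ (sumModel M₁s) y (sumModel M₂s) (iso.e y)) ∨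
  -- (b) both final clusters are non-degenerate and realize all atomic σ-types of the
  -- other model
  (∃ c₁ c₂, (sumModel M₁s).F.FinalCl c₁ ∧ (sumModel M₂s).F.FinalCl c₂ ∧
     (sumModel M₁s).F.R c₁ c₁ ∧ (sumModel M₂s).F.R c₂ c₂ ∧
     (∀ y₁, ∃ y₂ ∈ (sumModel M₂s).F.cluster c₂,
        SigAgree σ (sumModel M₁s) y₁ (sumModel M₂s) y₂) ∧
     (∀ y₂, ∃ y₁ ∈ (sumModel M₁s).F.cluster c₁,
        SigAgree σ (sumModel M₁s) y₁ (sumModel M₂s) y₂)) ∨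
  -- (c) the last components are based on one and the same `C(k,∗)`, with matching
  -- atomic σ-types on the root cluster `A_k`, and the non-last components realize only
  -- atomic σ-types of `A_k`
  (∃ (h₁ : 0 < n₁) (h₂ : 0 < n₂) (k : ℕ), 0 < k ∧ k ≤ 2 ^ δ.card ∧
     ∃ (refl : Bool)
       (iso₁ : KFrameIso (M₁s (lastIdx n₁ h₁)).F (tadpoleFrame k refl))
       (iso₂ : KFrameIso (M₂s (lastIdx n₂ h₂)).F (tadpoleFrame k refl)),
       (∀ i : Fin k,
          SigAgree σ (M₁s (lastIdx n₁ h₁)) (iso₁.e.symm (Sum.inl i))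
                     (M₂s (lastIdx n₂ h₂)) (iso₂.e.symm (Sum.inl i))) ∧
       (∀ j : Fin n₁, j ≠ lastIdx n₁ h₁ → ∀ y₁ : V₁ j, ∃ i : Fin k,
          SigAgree σ (M₁s j) y₁ (M₂s (lastIdx n₂ h₂)) (iso₂.e.symm (Sum.inl i))) ∧
       (∀ j : Fin n₂, j ≠ lastIdx n₂ h₂ → ∀ y₂ : V₂ j, ∃ i : Fin k,
          SigAgree σ (M₁s (lastIdx n₁ h₁)) (iso₁.e.symm (Sum.inl i)) (M₂s j) y₂))

/-! ## Transfer along isomorphisms and ordered sums -/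

/-- transitivity and linearity of a relation up to clusters -/
def IsLinearRel {W : Type} (R : W → W → Prop) : Prop :=
  (∀ x y z, R x y → R y z → R x z) ∧ ∀ x y, x = y ∨ R x y ∨ R y x

theorem KFrameIso.isLinearRel {W₁ W₂ : Type} {F₁ : KFrame W₁} {F₂ : KFrame W₂}
    (iso : KFrameIso F₁ F₂) (h : IsLinearRel F₂.R) : IsLinearRel F₁.R := by
  refine ⟨fun x y z hxy hyz => ?_, fun x y => ?_⟩
  · rw [iso.hR] at *
    exact h.1 _ _ _ hxy hyz
  · rw [iso.hR x y, iso.hR y x, ← iso.e.injective.eq_iff]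
    exact h.2 _ _

theorem tadpoleR_isLinearRel (k : ℕ) (refl : Bool) : IsLinearRel (tadpoleR k refl) := by
  refine ⟨?_, ?_⟩
  · rintro (x | x) (y | y) (z | z) hxy hyz <;> (simp only [tadpoleR] at *; try grind)
  · rintro (x | x) (y | y) <;> simp only [tadpoleR, Sum.inr.injEq] <;> grind

theorem IsAtomicFrame.isLinearRel {W : Type} {δ : Finset ℕ} {F : KFrame W}
    (h : IsAtomicFrame δ F) : IsLinearRel F.R := by
  obtain ⟨s, ⟨m, -, -, ⟨iso⟩⟩ | ⟨m, -, -, ⟨iso⟩⟩ | ⟨k, -, -, -, ⟨iso⟩⟩ |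
    ⟨k, -, -, -, refl, ⟨iso⟩⟩⟩ := h
  · exact iso.isLinearRel ⟨fun x y z => lt_trans, fun x y => by
      rcases lt_trichotomy x y with h | h | h
      exacts [.inr (.inl h), .inl h, .inr (.inr h)]⟩
  · refine iso.isLinearRel ⟨fun x y z => ?_, fun x y => ?_⟩
    · simp only [reflChainFrame]
      grind
    · simp only [reflChainFrame]
      grind
  · exact iso.isLinearRel ⟨fun _ _ _ _ _ => trivial, fun _ _ => .inr (.inl trivial)⟩
  · exact iso.isLinearRel (tadpoleR_isLinearRel k refl)

section Sum

variable {n : ℕ} {V : Fin n → Type} {Rs : ∀ j, V j → V j → Prop}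

theorem sumR_same {i : Fin n} (a b : V i) : sumR Rs ⟨i, a⟩ ⟨i, b⟩ ↔ Rs i a b := by
  simp [sumR]

theorem sumR_isLinearRel (h : ∀ j, IsLinearRel (Rs j)) : IsLinearRel (sumR Rs) := by
  refine ⟨?_, ?_⟩
  · rintro ⟨i, a⟩ ⟨j, b⟩ ⟨l, c⟩ (hij | ⟨hij, hab⟩) (hjl | ⟨hjl, hbc⟩)
    · exact Or.inl (lt_trans hij hjl)
    · obtain rfl : j = l := hjl
      exact Or.inl hij
    · obtain rfl : i = j := hij
      exact Or.inl hjl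
    · obtain rfl : i = j := hij
      obtain rfl : i = l := hjl
      exact (sumR_same _ _).2 ((h _).1 _ _ _ hab hbc)
  · rintro ⟨i, a⟩ ⟨j, b⟩
    rcases lt_trichotomy i j with hij | rfl | hij
    · exact Or.inr (Or.inl (Or.inl hij))
    · rw [sumR_same, sumR_same]
      rcases (h i).2 a b with rfl | h
      exacts [Or.inl rfl, Or.inr h]
    · exact Or.inr (Or.inr (Or.inl hij))

end Sum

/-! ## Bisimulations between blocks -/

theorem SigAgree.symm {W₁ W₂ : Type} {σ : Set ℕ} {M₁ : KModel W₁} {M₂ : KModel W₂}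
    {x₁ : W₁} {x₂ : W₂} (h : SigAgree σ M₁ x₁ M₂ x₂) : SigAgree σ M₂ x₂ M₁ x₁ :=
  fun p hp => (h p hp).symm

/-- a bisimulation that is total on both sides and relates all agreeing roots -/
structure IsBlockBisim {W₁ W₂ : Type} (σ : Set ℕ) (M₁ : KModel W₁) (M₂ : KModel W₂)
    (β : W₁ → W₂ → Prop) : Prop where
  bisim : IsBisim σ M₁ M₂ β
  left_total : ∀ x₁, ∃ x₂, β x₁ x₂
  right_total : ∀ x₂, ∃ x₁, β x₁ x₂
  root : ∀ x₁ x₂, M₁.F.Rooted x₁ → M₂.F.Rooted x₂ → SigAgree σ M₁ x₁ M₂ x₂ → β x₁ x₂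

/-- block bisimulations can be glued along ordered sums of the same length -/
theorem isBisim_sumModel {N : ℕ} {V₁ V₂ : Fin N → Type} {σ : Set ℕ}
    {M₁ : ∀ l, KModel (V₁ l)} {M₂ : ∀ l, KModel (V₂ l)} {β : ∀ l, V₁ l → V₂ l → Prop}
    (h : ∀ l, IsBlockBisim σ (M₁ l) (M₂ l) (β l)) :
    IsBisim σ (sumModel M₁) (sumModel M₂)
      (fun x y => ∃ l a b, x = ⟨l, a⟩ ∧ y = ⟨l, b⟩ ∧ β l a b) := by
  rintro _ _ ⟨l, a, b, rfl, rfl, hab⟩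
  refine ⟨((h l).bisim a b hab).1, ?_, ?_⟩
  · rintro ⟨l', c⟩ (hlt | ⟨hl, hR⟩)
    · obtain ⟨d, hd⟩ := (h l').left_total c
      exact ⟨⟨l', d⟩, Or.inl hlt, l', c, d, rfl, rfl, hd⟩
    · obtain rfl : l = l' := hl
      obtain ⟨d, hR', hd⟩ := ((h _).bisim a b hab).2.1 c hR
      exact ⟨⟨_, d⟩, Or.inr ⟨rfl, hR'⟩, _, c, d, rfl, rfl, hd⟩
  · rintro ⟨l', d⟩ (hlt | ⟨hl, hR⟩)
    · obtain ⟨c, hc⟩ := (h l').right_total d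
      exact ⟨⟨l', c⟩, Or.inl hlt, l', c, d, rfl, rfl, hc⟩
    · obtain rfl : l = l' := hl
      obtain ⟨c, hR', hc⟩ := ((h _).bisim a b hab).2.2 d hR
      exact ⟨⟨_, c⟩, Or.inr ⟨rfl, hR'⟩, _, c, d, rfl, rfl, hc⟩

theorem KFrame.Rooted.rel_self {W : Type} {F : KFrame W} (hF : IsLinearRel F.R) {x z : W}
    (hx : F.Rooted x) (h : F.R z x) : F.R x x := by
  rcases hx z with rfl | h'
  exacts [h, hF.1 _ _ _ h' h]

/-- isomorphic models with matching `σ`-types -/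
theorem isBlockBisim_of_iso {W₁ W₂ : Type} {σ : Set ℕ} {M₁ : KModel W₁} {M₂ : KModel W₂}
    (h₁ : IsLinearRel M₁.F.R) (h₂ : IsLinearRel M₂.F.R) (iso : KFrameIso M₁.F M₂.F)
    (h : ∀ y, SigAgree σ M₁ y M₂ (iso.e y)) :
    IsBlockBisim σ M₁ M₂ (fun x y => y = iso.e x ∨
      M₁.F.Rooted x ∧ M₂.F.Rooted y ∧ SigAgree σ M₁ x M₂ y) := by
  refine ⟨?_, fun x => ⟨_, .inl rfl⟩, fun y => ⟨iso.e.symm y, .inl (by simp)⟩,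
    fun x y hx hy hxy => .inr ⟨hx, hy, hxy⟩⟩
  rintro x y (rfl | ⟨hx, hy, hxy⟩)
  · refine ⟨h x, fun z hz => ⟨_, (iso.hR _ _).1 hz, .inl rfl⟩, fun z hz => ?_⟩
    exact ⟨iso.e.symm z, by simpa [iso.hR] using hz, .inl (by simp)⟩
  · refine ⟨hxy, fun z hz => ⟨iso.e z, ?_, .inl rfl⟩,
      fun z hz => ⟨iso.e.symm z, ?_, .inl (by simp)⟩⟩
    · rcases hy (iso.e z) with rfl | h
      exacts [hy.rel_self h₂ ((iso.hR _ _).1 hz), h]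
    · rcases hx (iso.e.symm z) with rfl | h
      · refine hx.rel_self h₁ (z := iso.e.symm y) ?_
        simpa [iso.hR] using hz
      · exact h

theorem KFrame.FinalCl.rel_of_mem_cluster {W : Type} {F : KFrame W} (hF : IsLinearRel F.R)
    {c : W} (hc : F.FinalCl c) (hcc : F.R c c) (x : W) {y : W} (hy : y ∈ F.cluster c) :
    F.R x y := by
  have hxc : F.R x c := by
    rcases hF.2 x c with rfl | h | h
    · exact hcc
    · exact h
    · exact not_not.1 fun h' => hc x ⟨h, h'⟩
  rcases hy with rfl | ⟨hcy, -⟩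
  exacts [hxc, hF.1 _ _ _ hxc hcy]

/-- models whose final clusters are non-degenerate and realise all `σ`-types -/
theorem isBlockBisim_of_finalCl {W₁ W₂ : Type} {σ : Set ℕ} {M₁ : KModel W₁} {M₂ : KModel W₂}
    (h₁ : IsLinearRel M₁.F.R) (h₂ : IsLinearRel M₂.F.R) {c₁ : W₁} {c₂ : W₂}
    (hc₁ : M₁.F.FinalCl c₁) (hc₂ : M₂.F.FinalCl c₂) (hr₁ : M₁.F.R c₁ c₁) (hr₂ : M₂.F.R c₂ c₂)
    (ha₁ : ∀ y₁, ∃ y₂ ∈ M₂.F.cluster c₂, SigAgree σ M₁ y₁ M₂ y₂)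
    (ha₂ : ∀ y₂, ∃ y₁ ∈ M₁.F.cluster c₁, SigAgree σ M₁ y₁ M₂ y₂) :
    IsBlockBisim σ M₁ M₂ (fun x y => SigAgree σ M₁ x M₂ y) := by
  refine ⟨fun x y hxy => ⟨hxy, fun z _ => ?_, fun z _ => ?_⟩, fun x => ?_, fun y => ?_,
    fun _ _ _ _ h => h⟩
  · obtain ⟨w, hw, h⟩ := ha₁ z
    exact ⟨w, hc₂.rel_of_mem_cluster h₂ hr₂ y hw, h⟩
  · obtain ⟨w, hw, h⟩ := ha₂ z
    exact ⟨w, hc₁.rel_of_mem_cluster h₁ hr₁ x hw, h⟩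
  · obtain ⟨w, -, h⟩ := ha₁ x
    exact ⟨w, h⟩
  · obtain ⟨w, -, h⟩ := ha₂ y
    exact ⟨w, h⟩

/-! ## Models ending with a tadpole -/

/-- `F` consists of a part `U`, all of whose points see the points `a i ∈ U` and `b n`,
and of the points `b n`, related by `S` and seeing nothing else -/
structure HasTadpoleEnd {W ι : Type} (F : KFrame W) (S : ℕ → ℕ → Prop) (U : Set W)
    (a : ι → W) (b : ℕ → W) : Prop where
  cover : ∀ x, x ∈ U ∨ ∃ n, x = b n
  a_mem : ∀ i, a i ∈ U
  a_ne_b : ∀ i n, a i ≠ b n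
  rel_a : ∀ x ∈ U, ∀ i, F.R x (a i)
  rel_b : ∀ x ∈ U, ∀ n, F.R x (b n)
  b_rel : ∀ n x, F.R (b n) x ↔ ∃ m, x = b m ∧ S n m

namespace HasTadpoleEnd

variable {W W₁ W₂ ι : Type} {S : ℕ → ℕ → Prop}

theorem mem_of_rooted [Nonempty ι] {F : KFrame W} {U : Set W} {a : ι → W} {b : ℕ → W}
    (h : HasTadpoleEnd F S U a b) {x : W} (hx : F.Rooted x) : x ∈ U := by
  obtain ⟨i⟩ := ‹Nonempty ι›
  refine (h.cover x).resolve_right ?_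
  rintro ⟨n, rfl⟩
  rcases hx (a i) with hi | hi
  · exact h.a_ne_b _ _ hi.symm
  · obtain ⟨m, hm, -⟩ := (h.b_rel _ _).1 hi
    exact h.a_ne_b _ _ hm

variable {σ : Set ℕ} {M₁ : KModel W₁} {M₂ : KModel W₂} {U₁ : Set W₁} {U₂ : Set W₂}
  {a₁ : ι → W₁} {a₂ : ι → W₂} {b₁ : ℕ → W₁} {b₂ : ℕ → W₂}

theorem isBlockBisim [Nonempty ι]
    (h₁ : HasTadpoleEnd M₁.F S U₁ a₁ b₁) (h₂ : HasTadpoleEnd M₂.F S U₂ a₂ b₂)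
    (hb : ∀ n, SigAgree σ M₁ (b₁ n) M₂ (b₂ n))
    (hU₁ : ∀ x ∈ U₁, ∃ i, SigAgree σ M₁ x M₂ (a₂ i))
    (hU₂ : ∀ x ∈ U₂, ∃ i, SigAgree σ M₁ (a₁ i) M₂ x) :
    IsBlockBisim σ M₁ M₂ (fun x y => (∃ n, x = b₁ n ∧ y = b₂ n) ∨
      x ∈ U₁ ∧ y ∈ U₂ ∧ SigAgree σ M₁ x M₂ y) where
  bisim := by
    rintro x y (⟨n, rfl, rfl⟩ | ⟨hx, hy, hxy⟩)
    · refine ⟨hb n, fun z hz => ?_, fun z hz => ?_⟩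
      · obtain ⟨m, rfl, hm⟩ := (h₁.b_rel _ _).1 hz
        exact ⟨b₂ m, (h₂.b_rel _ _).2 ⟨m, rfl, hm⟩, .inl ⟨m, rfl, rfl⟩⟩
      · obtain ⟨m, rfl, hm⟩ := (h₂.b_rel _ _).1 hz
        exact ⟨b₁ m, (h₁.b_rel _ _).2 ⟨m, rfl, hm⟩, .inl ⟨m, rfl, rfl⟩⟩
    · refine ⟨hxy, fun z _ => ?_, fun z _ => ?_⟩
      · rcases h₁.cover z with hz | ⟨m, rfl⟩
        · obtain ⟨i, hi⟩ := hU₁ z hz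
          exact ⟨a₂ i, h₂.rel_a _ hy i, .inr ⟨hz, h₂.a_mem i, hi⟩⟩
        · exact ⟨b₂ m, h₂.rel_b _ hy m, .inl ⟨m, rfl, rfl⟩⟩
      · rcases h₂.cover z with hz | ⟨m, rfl⟩
        · obtain ⟨i, hi⟩ := hU₂ z hz
          exact ⟨a₁ i, h₁.rel_a _ hx i, .inr ⟨h₁.a_mem i, hz, hi⟩⟩
        · exact ⟨b₁ m, h₁.rel_b _ hx m, .inl ⟨m, rfl, rfl⟩⟩
  left_total x := by
    rcases h₁.cover x with hx | ⟨n, rfl⟩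
    · obtain ⟨i, hi⟩ := hU₁ x hx
      exact ⟨a₂ i, .inr ⟨hx, h₂.a_mem i, hi⟩⟩
    · exact ⟨b₂ n, .inl ⟨n, rfl, rfl⟩⟩
  right_total y := by
    rcases h₂.cover y with hy | ⟨n, rfl⟩
    · obtain ⟨i, hi⟩ := hU₂ y hy
      exact ⟨a₁ i, .inr ⟨h₁.a_mem i, hy, hi⟩⟩
    · exact ⟨b₁ n, .inl ⟨n, rfl, rfl⟩⟩
  root x y hx hy hxy := .inr ⟨h₁.mem_of_rooted hx, h₂.mem_of_rooted hy, hxy⟩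

end HasTadpoleEnd

theorem lt_lastIdx {n : ℕ} (h : 0 < n) {j : Fin n} (hj : j ≠ lastIdx n h) :
    j < lastIdx n h := by
  simp only [lastIdx, ne_eq, Fin.ext_iff, Fin.lt_def] at *
  omega

/-- the points of an ordered sum outside the tail of the tadpole in its last component -/
def upperPart {n : ℕ} (h : 0 < n) {V : Fin n → Type} {k : ℕ}
    (a : Fin k → V (lastIdx n h)) : Set (Σ j, V j) :=
  {x | x.1 ≠ lastIdx n h ∨ ∃ i, x = ⟨lastIdx n h, a i⟩}

theorem hasTadpoleEnd_sumModel {n : ℕ} (h : 0 < n) {V : Fin n → Type}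
    (Ms : ∀ j, KModel (V j)) {k : ℕ} {refl : Bool}
    (iso : KFrameIso (Ms (lastIdx n h)).F (tadpoleFrame k refl)) :
    HasTadpoleEnd (sumModel Ms).F (fun n m => m < n ∨ (refl = true ∧ m = n))
      (upperPart h fun i : Fin k => iso.e.symm (Sum.inl i))
      (fun i : Fin k => ⟨lastIdx n h, iso.e.symm (Sum.inl i)⟩)
      (fun m => ⟨lastIdx n h, iso.e.symm (Sum.inr m)⟩) := by
  have hR : ∀ u v, (sumModel Ms).F.R ⟨lastIdx n h, iso.e.symm u⟩ ⟨lastIdx n h, iso.e.symm v⟩ ↔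
      tadpoleR k refl u v := by
    intro u v
    refine (sumR_same (Rs := fun j => (Ms j).F.R) _ _).trans ?_
    rw [iso.hR, Equiv.apply_symm_apply, Equiv.apply_symm_apply]
    rfl
  have hupper : ∀ x ∈ upperPart h fun i : Fin k => iso.e.symm (Sum.inl i), ∀ v,
      (sumModel Ms).F.R x ⟨lastIdx n h, iso.e.symm v⟩ := by
    rintro ⟨j, x⟩ (hj | ⟨i, hi⟩) v
    · exact Or.inl (lt_lastIdx h hj)
    · rw [hi, hR]
      trivial
  refine ⟨?_, fun i => .inr ⟨i, rfl⟩, fun i m hi => ?_, fun x hx i => hupper x hx _,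
    fun x hx m => hupper x hx _, ?_⟩
  · rintro ⟨j, x⟩
    by_cases hj : j = lastIdx n h
    · subst hj
      obtain ⟨u | m, rfl⟩ := iso.e.symm.surjective x
      exacts [.inl (.inr ⟨u, rfl⟩), .inr ⟨m, rfl⟩]
    · exact .inl (.inl hj)
  · simp at hi
  · rintro m ⟨j, x⟩
    constructor
    · intro hx
      obtain rfl : lastIdx n h = j := by
        rcases hx with hlt | ⟨hj, -⟩
        · by_contra hj
          exact lt_asymm hlt (lt_lastIdx h (Ne.symm hj))
        · exact hj
      obtain ⟨u | l, rfl⟩ := iso.e.symm.surjective x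
      · exact ((hR _ _).1 hx).elim
      · exact ⟨l, rfl, (hR _ _).1 hx⟩
    · rintro ⟨l, hl, hlm⟩
      rw [hl]
      exact (hR _ _).2 hlm

/-! ## Valuations on tadpoles -/

/-- internal sets of a tadpole are eventually determined by its root cluster -/
theorem genBy_tadpole_eventually {k : ℕ} (hk : 0 < k) {refl : Bool} {X : Set (Fin k ⊕ ℕ)}
    (h : genBy (tadpoleR k refl) (tadpoleGen k) X) :
    ∃ N, ∀ n ≥ N, (Sum.inr n ∈ X ↔ Sum.inl ⟨n % k, Nat.mod_lt n hk⟩ ∈ X) := by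
  induction h with
  | basic hX =>
    rcases hX with ⟨m, rfl⟩ | ⟨i, rfl⟩
    · refine ⟨m + 1, fun n hn => ?_⟩
      simp only [Set.mem_singleton_iff, Sum.inr.injEq, reduceCtorEq, iff_false]
      omega
    · refine ⟨0, fun n _ => ?_⟩
      simp [tadpoleX, Fin.ext_iff]
  | empty => exact ⟨0, fun _ _ => Iff.rfl⟩
  | univ => exact ⟨0, fun _ _ => Iff.rfl⟩
  | inter _ _ hX hY =>
    obtain ⟨N, hN⟩ := hX
    obtain ⟨N', hN'⟩ := hY
    refine ⟨max N N', fun n hn => ?_⟩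
    exact and_congr (hN n (le_trans (le_max_left _ _) hn)) (hN' n (le_trans (le_max_right _ _) hn))
  | compl _ hX =>
    obtain ⟨N, hN⟩ := hX
    exact ⟨N, fun n hn => not_congr (hN n hn)⟩
  | @dia X _ hX =>
    obtain ⟨N, hN⟩ := hX
    rcases X.eq_empty_or_nonempty with rfl | ⟨x, hx⟩
    · exact ⟨0, fun n _ => by simp⟩
    · obtain ⟨m, hm⟩ : ∃ m : ℕ, Sum.inr m ∈ X := by
        rcases x with i | m
        · refine ⟨i + k * N, (hN _ ?_).2 ?_⟩
          · nlinarith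
          · simpa [Nat.mod_eq_of_lt i.2] using hx
        · exact ⟨m, hx⟩
      refine ⟨m + 1, fun n hn => ?_⟩
      exact iff_of_true ⟨_, hm, Or.inl hn⟩ ⟨_, hm, trivial⟩

/-- the number of points strictly above `x` -/
noncomputable def KFrame.coheight {W : Type} (F : KFrame W) (x : W) : ℕ∞ :=
  {y | F.clLT x y}.encard

theorem KFrameIso.coheight_eq {W₁ W₂ : Type} {F₁ : KFrame W₁} {F₂ : KFrame W₂}
    (iso : KFrameIso F₁ F₂) (x : W₁) : F₂.coheight (iso.e x) = F₁.coheight x := by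
  have : {y | F₂.clLT (iso.e x) y} = iso.e '' {y | F₁.clLT x y} := by
    ext y
    obtain ⟨y, rfl⟩ := iso.e.surjective y
    simp [KFrame.clLT, iso.hR]
  rw [KFrame.coheight, this, iso.e.injective.encard_image, KFrame.coheight]

theorem coheight_tadpole_inr (k : ℕ) (refl : Bool) (n : ℕ) :
    (tadpoleFrame k refl).coheight (Sum.inr n) = n := by
  have : {y | (tadpoleFrame k refl).clLT (Sum.inr n) y} = Sum.inr '' Set.Iio n := by
    ext (i | m) <;> simp only [KFrame.clLT, tadpoleFrame, tadpoleR, Set.mem_ofPred_eq,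
      Set.mem_image, Set.mem_Iio, reduceCtorEq, Sum.inr.injEq, and_false, false_and,
      exists_false, exists_eq_right]
    grind
  rw [KFrame.coheight, this, Sum.inr_injective.encard_image, ← Finset.coe_Iio,
    Set.encard_coe_eq_coe_finsetCard, Nat.card_Iio]

theorem coheight_tadpole_inl (k : ℕ) (refl : Bool) (i : Fin k) :
    (tadpoleFrame k refl).coheight (Sum.inl i) = ⊤ := by
  refine Set.encard_eq_top_iff.2 ((Set.infinite_range_of_injective Sum.inr_injective).mono ?_)
  rintro _ ⟨m, rfl⟩
  exact ⟨trivial, fun h => h⟩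

theorem eq_inr_of_coheight {k : ℕ} {refl : Bool} {x : Fin k ⊕ ℕ} {n : ℕ}
    (h : (tadpoleFrame k refl).coheight x = n) : x = Sum.inr n := by
  rcases x with i | m
  · rw [coheight_tadpole_inl] at h
    exact (ENat.top_ne_natCast n h).elim
  · rw [coheight_tadpole_inr] at h
    rw [Nat.cast_injective h]

/-- in a simple model on a tadpole the tail repeats the `δ`-types of the root cluster,
whatever isomorphism is used to identify the frame -/
theorem IsSimpleModel.tail_iff {W : Type} {δ : Finset ℕ} {M : KModel W}
    (hM : M.IsModel) (hs : IsSimpleModel δ M) {k : ℕ} (hk : 0 < k) {refl : Bool}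
    (iso : KFrameIso M.F (tadpoleFrame k refl)) {p : ℕ} (hp : p ∈ δ) (n : ℕ) :
    iso.e.symm (Sum.inr n) ∈ M.v p ↔
      iso.e.symm (Sum.inl ⟨n % k, Nat.mod_lt n hk⟩) ∈ M.v p := by
  rcases hs with ⟨hfin, -⟩ | ⟨k', hk', refl', iso', hv⟩
  · exact (not_finite_iff_infinite.2 (inferInstanceAs (Infinite (Fin k ⊕ ℕ)))
      (Finite.of_equiv W iso.e)).elim
  obtain ⟨A, hA⟩ := hv p hp
  have hinr : ∀ m, iso'.e (iso.e.symm (Sum.inr m)) = Sum.inr m := fun m =>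
    eq_inr_of_coheight (refl := refl') (by
      rw [iso'.coheight_eq, ← iso.coheight_eq, Equiv.apply_symm_apply, coheight_tadpole_inr])
  have hmem : ∀ m, iso.e.symm (Sum.inr m) ∈ M.v p ↔ ∃ i ∈ A, m % k' = i.val := by
    intro m
    rw [← iso'.e.injective.mem_set_image, hA, hinr]
    simp [tadpoleX]
  obtain ⟨N, hN⟩ := genBy_tadpole_eventually hk ((iso.hP _).1 (hM.2 p))
  have hN' := hN (n + k * (k' * N)) (by
    have := Nat.mul_pos hk hk'
    nlinarith)
  simp only [Nat.add_mul_mod_self_left, Equiv.image_eq_preimage_symm,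
    Set.mem_preimage] at hN'
  rw [← hN', hmem, hmem, Nat.mul_left_comm, Nat.add_mul_mod_self_left]

/-- σ-matching blocks are linked by a block bisimulation -/
theorem SigMatching.exists_isBlockBisim {δ : Finset ℕ} {σ : Set ℕ} (hσδ : σ ⊆ ↑δ) {n₁ n₂ : ℕ}
    {V₁ : Fin n₁ → Type} {V₂ : Fin n₂ → Type}
    {M₁ : ∀ j, KModel (V₁ j)} {M₂ : ∀ j, KModel (V₂ j)}
    (hs₁ : ∀ j, (M₁ j).IsModel ∧ IsDeltaModel δ (M₁ j) ∧
        IsSimpleModel δ (M₁ j) ∧ IsAtomicFrame δ (M₁ j).F)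
    (hs₂ : ∀ j, (M₂ j).IsModel ∧ IsDeltaModel δ (M₂ j) ∧
        IsSimpleModel δ (M₂ j) ∧ IsAtomicFrame δ (M₂ j).F)
    (h : SigMatching δ σ M₁ M₂) :
    ∃ β, IsBlockBisim σ (sumModel M₁) (sumModel M₂) β := by
  have hl₁ : IsLinearRel (sumModel M₁).F.R := sumR_isLinearRel fun j => (hs₁ j).2.2.2.isLinearRel
  have hl₂ : IsLinearRel (sumModel M₂).F.R := sumR_isLinearRel fun j => (hs₂ j).2.2.2.isLinearRel
  rcases h with ⟨-, -, -, -, iso, h⟩ | ⟨c₁, c₂, hc₁, hc₂, hr₁, hr₂, ha₁, ha₂⟩ |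
    ⟨h₁, h₂, k, hk, -, refl, iso₁, iso₂, ha, hu₁, hu₂⟩
  · exact ⟨_, isBlockBisim_of_iso hl₁ hl₂ iso h⟩
  · exact ⟨_, isBlockBisim_of_finalCl hl₁ hl₂ hc₁ hc₂ hr₁ hr₂ ha₁ ha₂⟩
  · have : Nonempty (Fin k) := ⟨⟨0, hk⟩⟩
    refine ⟨_, (hasTadpoleEnd_sumModel h₁ M₁ iso₁).isBlockBisim
      (hasTadpoleEnd_sumModel h₂ M₂ iso₂) (fun n p hp => ?_) ?_ ?_⟩
    · exact ((hs₁ _).2.2.1.tail_iff (hs₁ _).1 hk iso₁ (hσδ hp) n).trans <|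
        (ha _ p hp).trans ((hs₂ _).2.2.1.tail_iff (hs₂ _).1 hk iso₂ (hσδ hp) n).symm
    · rintro ⟨j, x⟩ (hj | ⟨i, hi⟩)
      · exact hu₁ j hj x
      · exact ⟨i, hi ▸ ha i⟩
    · rintro ⟨j, x⟩ (hj | ⟨i, hi⟩)
      · exact hu₂ j hj x
      · exact ⟨i, hi ▸ ha i⟩

/-- (Lemma `l:gbisall`) if `N₁`, `N₂` are ordered sums of `N` blocks, each
an ordered sum of simple `δ`-models based on atomic frames, the roots (taken in the first
blocks) satisfy the same `σ`-variables, and all corresponding pairs of blocks are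
σ-matching, then the models are σ-bisimilar at the roots. -/
theorem sigma_matching_implies_bisimilar (δ : Finset ℕ) (σ : Set ℕ) (hσδ : σ ⊆ ↑δ)
    (N : ℕ) (hN : 0 < N) (n₁ n₂ : Fin N → ℕ)
    (hn₁ : ∀ ℓ, 0 < (n₁ ℓ)) (hn₂ : ∀ ℓ, 0 < (n₂ ℓ))
    (V₁ : (ℓ : Fin N) → Fin (n₁ ℓ) → Type) (V₂ : (ℓ : Fin N) → Fin (n₂ ℓ) → Type)
    (Ms₁ : (ℓ : Fin N) → (j : Fin (n₁ ℓ)) → KModel (V₁ ℓ j))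
    (Ms₂ : (ℓ : Fin N) → (j : Fin (n₂ ℓ)) → KModel (V₂ ℓ j))
    (hs₁ : ∀ ℓ j, (Ms₁ ℓ j).IsModel ∧ IsDeltaModel δ (Ms₁ ℓ j) ∧
        IsSimpleModel δ (Ms₁ ℓ j) ∧ IsAtomicFrame δ (Ms₁ ℓ j).F)
    (hs₂ : ∀ ℓ j, (Ms₂ ℓ j).IsModel ∧ IsDeltaModel δ (Ms₂ ℓ j) ∧
        IsSimpleModel δ (Ms₂ ℓ j) ∧ IsAtomicFrame δ (Ms₂ ℓ j).F)
    (y₁ : Σ j : Fin (n₁ ⟨0, hN⟩), V₁ ⟨0, hN⟩ j)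
    (y₂ : Σ j : Fin (n₂ ⟨0, hN⟩), V₂ ⟨0, hN⟩ j)
    (hr₁ : (sumModel (Ms₁ ⟨0, hN⟩)).F.Rooted y₁)
    (hr₂ : (sumModel (Ms₂ ⟨0, hN⟩)).F.Rooted y₂)
    (hagree : SigAgree σ
      (sumModel (fun ℓ => sumModel (Ms₁ ℓ))) ⟨⟨0, hN⟩, y₁⟩
      (sumModel (fun ℓ => sumModel (Ms₂ ℓ))) ⟨⟨0, hN⟩, y₂⟩)
    (hmatch : ∀ ℓ : Fin N, SigMatching δ σ (Ms₁ ℓ) (Ms₂ ℓ)) :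
    Bisimilar σ
      (sumModel (fun ℓ => sumModel (Ms₁ ℓ))) ⟨⟨0, hN⟩, y₁⟩
      (sumModel (fun ℓ => sumModel (Ms₂ ℓ))) ⟨⟨0, hN⟩, y₂⟩ := by
  choose β hβ using fun ℓ => (hmatch ℓ).exists_isBlockBisim hσδ (hs₁ ℓ) (hs₂ ℓ)
  exact ⟨_, isBisim_sumModel hβ, _, y₁, y₂, rfl, rfl, (hβ _).root y₁ y₂ hr₁ hr₂ hagree⟩
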